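/- Let C be a clausal system and let p, q be basic sentences. Then {p} ∪ C intuitionistically proves q if and only if for every clausal system D with D ⊇ C, if D intuitionistically proves p then D intuitionistically proves q. -/

import Mathlib

/-- Formulas of intuitionistic propositional logic over a countably infinite
set of atomic propositions (basic sentences), identified with `ℕ`. -/
inductive Formula : Type where
  | atom : ℕ → Formula
  | bot  : Formula
  | and  : Formula → Formula → Formula
  | or   : Formula → Formula → Formula
  | imp  : Formula → Formula → Formula
deriving DecidableEq

/-- Derivability in intuitionistic propositional natural deduction (NJ)
from a set of hypotheses. -/
inductive NJ : Set Formula → Formula → Prop where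
  | hyp   {Γ : Set Formula} {φ : Formula}     : φ ∈ Γ → NJ Γ φ
  | andI  {Γ : Set Formula} {φ ψ : Formula}   : NJ Γ φ → NJ Γ ψ → NJ Γ (φ.and ψ)
  | andE1 {Γ : Set Formula} {φ ψ : Formula}   : NJ Γ (φ.and ψ) → NJ Γ φ
  | andE2 {Γ : Set Formula} {φ ψ : Formula}   : NJ Γ (φ.and ψ) → NJ Γ ψ
  | orI1  {Γ : Set Formula} {φ ψ : Formula}   : NJ Γ φ → NJ Γ (φ.or ψ)
  | orI2  {Γ : Set Formula} {φ ψ : Formula}   : NJ Γ ψ → NJ Γ (φ.or ψ)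
  | orE   {Γ : Set Formula} {φ ψ χ : Formula} : NJ Γ (φ.or ψ) → NJ (insert φ Γ) χ → NJ (insert ψ Γ) χ → NJ Γ χ
  | impI  {Γ : Set Formula} {φ ψ : Formula}   : NJ (insert φ Γ) ψ → NJ Γ (φ.imp ψ)
  | impE  {Γ : Set Formula} {φ ψ : Formula}   : NJ Γ (φ.imp ψ) → NJ Γ φ → NJ Γ ψ
  | botE  {Γ : Set Formula} {φ : Formula}     : NJ Γ Formula.bot → NJ Γ φ

/-- An atomic rule: either a nullary rule `ε ⇒ c`, or a general rule
`(P₁ ⇒ p₁),…,(Pₙ ⇒ pₙ) ⇒ c` with `n ≥ 1` (encoded as head premise plus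
a list of further premises), where each premise is a pair of a finite set
of basic sentences and a basic sentence. -/
inductive AtomicRule : Type where
  | nullary : ℕ → AtomicRule
  | general : (Finset ℕ × ℕ) → List (Finset ℕ × ℕ) → ℕ → AtomicRule

/-- A base is a set of atomic rules. -/
abbrev Base := Set AtomicRule

/-- Derivability in a base `B`: the smallest relation `P ⊢_B p` closed under
the three clauses. -/
inductive BaseDer (B : Base) : Set ℕ → ℕ → Prop where
  | hyp {P : Set ℕ} {p : ℕ} : p ∈ P → BaseDer B P p
  | nullary {P : Set ℕ} {c : ℕ} : AtomicRule.nullary c ∈ B → BaseDer B P c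
  | general {P : Set ℕ} {hd : Finset ℕ × ℕ} {tl : List (Finset ℕ × ℕ)} {c : ℕ} :
      AtomicRule.general hd tl c ∈ B →
      (∀ pr ∈ hd :: tl, BaseDer B (P ∪ ↑pr.1) pr.2) →
      BaseDer B P c

/-- Sandqvist's support relation `⊩_B φ`, defined by recursion on the
structure of `φ` (equivalently, on logical weight). -/
def Supp : Base → Formula → Prop
  | B, .atom p  => BaseDer B ∅ p
  | B, .bot     => ∀ p : ℕ, BaseDer B ∅ p
  | B, .and φ ψ => Supp B φ ∧ Supp B ψ
  | B, .or φ ψ  => ∀ C : Base, B ⊆ C → ∀ p : ℕ,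
      (∀ D : Base, C ⊆ D → Supp D φ → BaseDer D ∅ p) →
      (∀ D : Base, C ⊆ D → Supp D ψ → BaseDer D ∅ p) →
      BaseDer C ∅ p
  | B, .imp φ ψ => ∀ C : Base, B ⊆ C → Supp C φ → Supp C ψ

/-- Support relative to a context: `Γ ⊩_B φ`. -/
def SuppCtx (Γ : Set Formula) (B : Base) (φ : Formula) : Prop :=
  ∀ C : Base, B ⊆ C → (∀ ψ ∈ Γ, Supp C ψ) → Supp C φ

/-- `f` is a (possibly iterated) conjunction `p₁ ∧ … ∧ pₙ` (n ≥ 1) of atoms. -/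
inductive AtomsConj : Formula → Prop where
  | atom (p : ℕ) : AtomsConj (.atom p)
  | and {a b : Formula} : AtomsConj a → AtomsConj b → AtomsConj (a.and b)

/-- `q*` : either a basic sentence or `⊥`. -/
def AtomOrBot (f : Formula) : Prop := (∃ p : ℕ, f = .atom p) ∨ f = .bot

/-- An intuitionistic clause in the sense of Mints: a formula of one of the
forms `(p → q*) → r`, `p → (q ∨ r)`, or `(p₁ ∧ … ∧ pₙ) → q*`. -/
inductive IsClause : Formula → Prop where
  | impImp (p r : ℕ) {q : Formula} : AtomOrBot q →
      IsClause (((Formula.atom p).imp q).imp (.atom r))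
  | impOr (p q r : ℕ) :
      IsClause ((Formula.atom p).imp ((Formula.atom q).or (.atom r)))
  | conjImp {a q : Formula} : AtomsConj a → AtomOrBot q →
      IsClause (a.imp q)

/-- A clausal system: a set of intuitionistic clauses. -/
def ClausalSystem (C : Set Formula) : Prop := ∀ f ∈ C, IsClause f

/-- The set of subformulas of a formula. -/
def subf : Formula → Finset Formula
  | .atom p  => {.atom p}
  | .bot     => {.bot}
  | .and a b => insert (a.and b) (subf a ∪ subf b)
  | .or a b  => insert (a.or b) (subf a ∪ subf b)
  | .imp a b => insert (a.imp b) (subf a ∪ subf b)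

/-- `⊥` occurs in `φ` only as the conclusion of an implication. -/
def BotGuarded : Formula → Prop
  | .atom _  => True
  | .bot     => False
  | .and a b => BotGuarded a ∧ BotGuarded b
  | .or a b  => BotGuarded a ∧ BotGuarded b
  | .imp a b => BotGuarded a ∧ (b = .bot ∨ BotGuarded b)

/-- `fl` is a flattening for `φ`: an injection from `Ξ ∪ {⊥}` (where `Ξ` is
the set of subformulas of `φ`) into the basic sentences which fixes the
atoms of `Ξ`. -/
def FlatFor (fl : Formula → ℕ) (φ : Formula) : Prop :=
  (∀ a ∈ insert Formula.bot (subf φ), ∀ b ∈ insert Formula.bot (subf φ),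
      fl a = fl b → a = b) ∧
  (∀ p : ℕ, Formula.atom p ∈ subf φ → fl (.atom p) = p)

/-- The clauses `M_X(χ)` associated with a complex subformula `χ`, relative
to a set `X` of basic sentences. -/
def MX (fl : Formula → ℕ) (X : Set ℕ) : Formula → Set Formula
  | .and a b =>
      { (Formula.atom (fl (a.and b))).imp (.atom (fl a)),
        (Formula.atom (fl (a.and b))).imp (.atom (fl b)),
        ((Formula.atom (fl a)).and (.atom (fl b))).imp (.atom (fl (a.and b))) }
  | .or a b =>
      { (Formula.atom (fl a)).imp (.atom (fl (a.or b))),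
        (Formula.atom (fl b)).imp (.atom (fl (a.or b))) } ∪
      { f | ∃ x ∈ X, f =
          (((Formula.atom (fl (a.or b))).and
              ((Formula.atom (fl a)).imp (.atom x))).and
            ((Formula.atom (fl b)).imp (.atom x))).imp (.atom x) }
  | .imp a b =>
      { ((Formula.atom (fl a)).imp (.atom (fl b))).imp (.atom (fl (a.imp b))),
        ((Formula.atom (fl (a.imp b))).and (.atom (fl a))).imp (.atom (fl b)) }
  | _ => ∅

/-- The clause set `N := ⋃_{χ ∈ Ξ} M_𝔹(χ) ∪ {⊥♭ → x : x ∈ 𝔹}`, relative to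
all basic sentences. -/
def Nset (fl : Formula → ℕ) (φ : Formula) : Set Formula :=
  (⋃ χ ∈ (↑(subf φ) : Set Formula), MX fl Set.univ χ) ∪
  { f | ∃ x : ℕ, f = (Formula.atom (fl .bot)).imp (.atom x) }

/-- Right-nested conjunction of a nonempty list of atoms (`⊥` for the empty
list, which never occurs below). -/
def conjAtoms : List ℕ → Formula
  | []            => .bot
  | [p]           => .atom p
  | p :: q :: rest => (Formula.atom p).and (conjAtoms (q :: rest))

/-- Canonical conjunction `⋀X` of a finite set of atoms. -/
def bigConj (X : Finset ℕ) : Formula := conjAtoms (X.sort (· ≤ ·))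

/-- The atoms occurring in a formula. -/
def atomsOf : Formula → Finset ℕ
  | .atom p  => {p}
  | .bot     => ∅
  | .and a b => atomsOf a ∪ atomsOf b
  | .or a b  => atomsOf a ∪ atomsOf b
  | .imp a b => atomsOf a ∪ atomsOf b

/-- `X`, the range of the flattening `fl` on `Ξ ∪ {⊥}`. -/
def flatRange (fl : Formula → ℕ) (φ : Formula) : Finset ℕ :=
  (insert Formula.bot (subf φ)).image fl

/-- Mints' full clause set
`M_X := ⋃_{χ ∈ Ξ} M_X(χ) ∪ {(⋀X ∧ y) → ⊥♭} ∪ {⊥♭ → y} ∪ {⊥♭ → x : x ∈ X}`,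
where `y` is a fresh basic sentence. -/
def MXfull (fl : Formula → ℕ) (φ : Formula) (y : ℕ) : Set Formula :=
  (⋃ χ ∈ (↑(subf φ) : Set Formula), MX fl ↑(flatRange fl φ) χ) ∪
  { ((bigConj (flatRange fl φ)).and (.atom y)).imp (.atom (fl .bot)),
    (Formula.atom (fl .bot)).imp (.atom y) } ∪
  { f | ∃ x ∈ flatRange fl φ, f = (Formula.atom (fl .bot)).imp (.atom x) }

/-- `φ[q/⊥]`: replace every occurrence of `⊥` by the atom `q`. -/
def substBot (q : ℕ) : Formula → Formula
  | .atom p  => .atom p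
  | .bot     => .atom q
  | .and a b => (substBot q a).and (substBot q b)
  | .or a b  => (substBot q a).or (substBot q b)
  | .imp a b => (substBot q a).imp (substBot q b)

/-- Right-nested conjunction of a nonempty list of formulas. -/
def conjFmls : Formula → List Formula → Formula
  | f, []        => f
  | f, g :: rest => f.and (conjFmls g rest)

/-- The formula `⋀P → p` associated with a premise `(P ⇒ p)`, with
`⋀∅ → p` read as `p`. -/
def premFml (pr : Finset ℕ × ℕ) : Formula :=
  if pr.1 = ∅ then .atom pr.2
  else (conjAtoms (pr.1.sort (· ≤ ·))).imp (.atom pr.2)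

/-- The translation `[−]` from atomic rules to formulas:
`[ε ⇒ c] = c` and
`[(P₁ ⇒ p₁),…,(Pₙ ⇒ pₙ) ⇒ c] = ((⋀P₁ → p₁) ∧ … ∧ (⋀Pₙ → pₙ)) → c`. -/
def ruleTr : AtomicRule → Formula
  | .nullary c       => .atom c
  | .general hd tl c => (conjFmls (premFml hd) (tl.map premFml)).imp (.atom c)

/-- The translation of a base: `[𝓑] := {[r] : r ∈ 𝓑}`. -/
def baseTr (B : Base) : Set Formula := ruleTr '' B

/-- Weakening for natural deduction. -/
theorem NJ.weaken {Γ Δ : Set Formula} {φ : Formula} (h : NJ Γ φ) (hΓΔ : Γ ⊆ Δ) : NJ Δ φ := by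
  induction h generalizing Δ with
  | hyp h => exact .hyp (hΓΔ h)
  | andI _ _ ih₁ ih₂ => exact .andI (ih₁ hΓΔ) (ih₂ hΓΔ)
  | andE1 _ ih => exact .andE1 (ih hΓΔ)
  | andE2 _ ih => exact .andE2 (ih hΓΔ)
  | orI1 _ ih => exact .orI1 (ih hΓΔ)
  | orI2 _ ih => exact .orI2 (ih hΓΔ)
  | orE _ _ _ ih ih₁ ih₂ =>
    exact .orE (ih hΓΔ) (ih₁ (Set.insert_subset_insert hΓΔ)) (ih₂ (Set.insert_subset_insert hΓΔ))
  | impI _ ih => exact .impI (ih (Set.insert_subset_insert hΓΔ))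
  | impE _ _ ih₁ ih₂ => exact .impE (ih₁ hΓΔ) (ih₂ hΓΔ)
  | botE _ ih => exact .botE (ih hΓΔ)

/-- The cut rule, with the cut formula derived from a larger context. -/
theorem NJ.cut {Γ Δ : Set Formula} {φ ψ : Formula} (h : NJ (insert φ Γ) ψ) (hΓΔ : Γ ⊆ Δ)
    (hφ : NJ Δ φ) : NJ Δ ψ :=
  .impE (h.impI.weaken hΓΔ) hφ

/-- For a clausal system `C` and basic sentences `p, q`:
`{p} ∪ C ⊢ q` iff for every clausal system `D ⊇ C`, `D ⊢ p` implies `D ⊢ q`. -/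
theorem clausal_inference (C : Set Formula) (hC : ClausalSystem C) (p q : ℕ) :
    NJ (insert (.atom p) C) (.atom q) ↔
      ∀ D : Set Formula, ClausalSystem D → C ⊆ D →
        NJ D (.atom p) → NJ D (.atom q) := by
  refine ⟨fun h D _ hCD hp => h.cut hCD hp, fun h => ?_⟩
  -- The clause `(p → p) → p` is equivalent to the basic sentence `p`.
  let clause : Formula := ((Formula.atom p).imp (.atom p)).imp (.atom p)
  have hD : ClausalSystem (insert clause C) := by
    rintro f (rfl | hf)
    · exact .impImp p p (.inl ⟨p, rfl⟩)
    · exact hC f hf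
  have hp : NJ (insert clause C) (.atom p) :=
    .impE (.hyp (Set.mem_insert _ _)) (.impI (.hyp (Set.mem_insert _ _)))
  refine (h _ hD (Set.subset_insert _ _) hp).cut (Set.subset_insert _ _) ?_
  exact .impI (.hyp (Set.mem_insert_of_mem _ (Set.mem_insert _ _)))
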